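/- Equi-Lipschitz continuity in time of the mean velocity scheme. Let V be a probability vector field satisfying (H1) with constant C > 0, let T > 0 and μ₀ ∈ 𝒫_c(ℝ^d) with supp(μ₀) ⊂ B(0,R). Let K = K(R,T) be a uniform bound on the support radii of the scheme (e.g. K = e^{CT}(1+R) − 1). Then for every N ∈ ℕ, W(μ̂^N_t, μ̂^N_s) ≤ C(1+K)|t − s| for all t, s ∈ [0,T]. -/

import Mathlib

open MeasureTheory Set Filter Topology Metric
open scoped ENNReal NNReal Classical

noncomputable section

abbrev Euc (d : ℕ) : Type := EuclideanSpace ℝ (Fin d)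

/-- The (topological) support of a measure. -/
def msupp {X : Type*} [TopologicalSpace X] [MeasurableSpace X] (μ : Measure X) : Set X :=
  {x | ∀ U : Set X, IsOpen U → x ∈ U → 0 < μ U}

/-- Compactly supported Borel probability measures (membership in `𝒫_c`). -/
def Pc {X : Type*} [TopologicalSpace X] [MeasurableSpace X] (μ : Measure X) : Prop :=
  IsProbabilityMeasure μ ∧ ∃ K : Set X, IsCompact K ∧ μ Kᶜ = 0

/-- A probability vector field: `π₁ ♯ V[μ] = μ`. -/
def IsPVF {d : ℕ} (V : Measure (Euc d) → Measure (Euc d × Euc d)) : Prop :=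
  ∀ μ : Measure (Euc d), IsProbabilityMeasure μ →
    IsProbabilityMeasure (V μ) ∧ (V μ).map Prod.fst = μ

/-- Solution of the measure differential equation `μ̇_t = V[μ_t]` on `[0,T]`. -/
def IsMDESol {d : ℕ} (T : ℝ) (V : Measure (Euc d) → Measure (Euc d × Euc d))
    (μ : ℝ → Measure (Euc d)) : Prop :=
  ∀ f : Euc d → ℝ, ContDiff ℝ (⊤ : ℕ∞) f → HasCompactSupport f →
    IntegrableOn (fun t => ∫ p : Euc d × Euc d, fderiv ℝ f p.1 p.2 ∂(V (μ t))) (Icc 0 T) ∧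
    ∀ t ∈ Icc (0 : ℝ) T,
      (∫ x, f x ∂(μ t)) - (∫ x, f x ∂(μ 0)) =
        ∫ s in Icc (0 : ℝ) t, (∫ p : Euc d × Euc d, fderiv ℝ f p.1 p.2 ∂(V (μ s)))

/-- 1-Wasserstein distance via the Kantorovich–Rubinstein duality. -/
def W1 {X : Type*} [MeasurableSpace X] [PseudoMetricSpace X] (μ ν : Measure X) : ℝ :=
  ⨆ f : {f : X → ℝ // LipschitzWith 1 f}, ((∫ x, f.1 x ∂μ) - ∫ x, f.1 x ∂ν)

/-- Disintegration `ν_x[·]` of a measure on a product space w.r.t. the first projection. -/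
def disint {d : ℕ} (m : Measure (Euc d × Euc d)) : Euc d → Measure (Euc d) :=
  if h : IsFiniteMeasure m then
    haveI := h
    fun x => m.condKernel x
  else fun _ => 0

/-- Barycenter of the disintegration: `x ↦ ∫ v dν_x(v)`. -/
def bary {d : ℕ} (m : Measure (Euc d × Euc d)) (x : Euc d) : Euc d :=
  ∫ v, v ∂(disint m x)


section Hypotheses

/-- Condition (H1) with a given constant `C`. -/
def H1cond {d : ℕ} (C : ℝ) (V : Measure (Euc d) → Measure (Euc d × Euc d)) : Prop :=
  ∀ μ : Measure (Euc d), Pc μ →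
    ∀ p ∈ msupp (V μ), ‖p.2‖ ≤ C * (1 + ⨆ x : msupp μ, ‖(x : Euc d)‖)

/-- Hypothesis (H1): sublinearity of the PVF. -/
def H1 {d : ℕ} (V : Measure (Euc d) → Measure (Euc d × Euc d)) : Prop :=
  ∃ C > 0, H1cond C V

/-- Hypothesis (H2): continuity of the PVF `V : 𝒫_c(ℝ^d) → 𝒫_c(Tℝ^d)` w.r.t. Wasserstein. -/
def H2 {d : ℕ} (V : Measure (Euc d) → Measure (Euc d × Euc d)) : Prop :=
  (∀ μ, Pc μ → Pc (V μ)) ∧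
  ∀ μ, Pc μ → ∀ ε > 0, ∃ δ > 0, ∀ ν, Pc ν → W1 μ ν < δ → W1 (V μ) (V ν) < ε

/-- Transference plans between two measures. -/
def Couplings {X Y : Type*} [MeasurableSpace X] [MeasurableSpace Y]
    (μ : Measure X) (ν : Measure Y) : Set (Measure (X × Y)) :=
  {π | π.map Prod.fst = μ ∧ π.map Prod.snd = ν}

/-- 1-Wasserstein distance as infimum over transference plans. -/
def Wplan {X : Type*} [MeasurableSpace X] [PseudoMetricSpace X] (μ ν : Measure X) : ℝ :=
  sInf ((fun π : Measure (X × X) => ∫ p, dist p.1 p.2 ∂π) '' Couplings μ ν)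

/-- Optimal transference plans. -/
def OptCouplings {X : Type*} [MeasurableSpace X] [PseudoMetricSpace X] (μ ν : Measure X) :
    Set (Measure (X × X)) :=
  {π | π ∈ Couplings μ ν ∧ (∫ p, dist p.1 p.2 ∂π) = Wplan μ ν}

/-- The quantity `𝒲(V₁,V₂)`: minimal fiber displacement over plans whose base marginal is
an optimal plan between the two base measures. -/
def Wfib {d : ℕ} (V₁ V₂ : Measure (Euc d × Euc d)) : ℝ :=
  sInf ((fun P : Measure ((Euc d × Euc d) × (Euc d × Euc d)) => ∫ q, ‖q.1.2 - q.2.2‖ ∂P) ''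
    {P | P ∈ Couplings V₁ V₂ ∧
      P.map (fun q => (q.1.1, q.2.1)) ∈ OptCouplings (V₁.map Prod.fst) (V₂.map Prod.fst)})

/-- Hypothesis (H3): local Lipschitz continuity of the PVF in the `μ` variable. -/
def H3 {d : ℕ} (V : Measure (Euc d) → Measure (Euc d × Euc d)) : Prop :=
  ∀ R > 0, ∃ L > 0, ∀ μ ν : Measure (Euc d), Pc μ → Pc ν →
    msupp μ ⊆ ball (0 : Euc d) R → msupp ν ⊆ ball (0 : Euc d) R →
    Wfib (V μ) (V ν) ≤ L * W1 μ ν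

end Hypotheses

section Schemes

/-- The semi-discrete (in time) Lagrangian scheme at grid times `t_k = k T/N`. -/
def lagrStep {d : ℕ} (T : ℝ) (N : ℕ) (V : Measure (Euc d) → Measure (Euc d × Euc d))
    (μ₀ : Measure (Euc d)) : ℕ → Measure (Euc d)
  | 0 => μ₀
  | k + 1 => (V (lagrStep T N V μ₀ k)).map fun p => p.1 + (T / N) • p.2

/-- Time interpolation of the semi-discrete Lagrangian scheme. -/
def lagrT {d : ℕ} (T : ℝ) (N : ℕ) (V : Measure (Euc d) → Measure (Euc d × Euc d))
    (μ₀ : Measure (Euc d)) (t : ℝ) : Measure (Euc d) :=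
  if t ≤ 0 then μ₀
  else
    (V (lagrStep T N V μ₀ (⌈t / (T / N)⌉.toNat - 1))).map fun p =>
      p.1 + (t - (↑(⌈t / (T / N)⌉.toNat - 1) : ℝ) * (T / N)) • p.2

/-- The mean velocity scheme at grid times `t_j = j T/N`. -/
def mvelStep {d : ℕ} (T : ℝ) (N : ℕ) (V : Measure (Euc d) → Measure (Euc d × Euc d))
    (μ₀ : Measure (Euc d)) : ℕ → Measure (Euc d)
  | 0 => μ₀
  | j + 1 => (mvelStep T N V μ₀ j).map fun x =>
      x + (T / N) • bary (V (mvelStep T N V μ₀ j)) x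

/-- Time interpolation of the mean velocity scheme. -/
def mvelT {d : ℕ} (T : ℝ) (N : ℕ) (V : Measure (Euc d) → Measure (Euc d × Euc d))
    (μ₀ : Measure (Euc d)) (t : ℝ) : Measure (Euc d) :=
  if t ≤ 0 then μ₀
  else
    (mvelStep T N V μ₀ (⌈t / (T / N)⌉.toNat - 1)).map fun x =>
      x + (t - (↑(⌈t / (T / N)⌉.toNat - 1) : ℝ) * (T / N)) •
        bary (V (mvelStep T N V μ₀ (⌈t / (T / N)⌉.toNat - 1))) x

end Schemes

theorem msupp_eq_support {X : Type*} [TopologicalSpace X] [MeasurableSpace X] (μ : Measure X) :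
    msupp μ = μ.support := by
  rw [Measure.support_eq_forall_isOpen]
  ext x
  exact ⟨fun h U hx hU => h U hU hx, fun h U hU hx => h U hx hU⟩

theorem ae_mem_msupp {X : Type*} [TopologicalSpace X] [SecondCountableTopology X]
    [MeasurableSpace X] (μ : Measure X) : ∀ᵐ x ∂μ, x ∈ msupp μ := by
  rw [msupp_eq_support]
  exact Measure.support_mem_ae

theorem msupp_nonempty {X : Type*} [TopologicalSpace X] [SecondCountableTopology X]
    [MeasurableSpace X] (μ : Measure X) [IsProbabilityMeasure μ] : (msupp μ).Nonempty :=
  (ae_mem_msupp μ).exists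

theorem pc_of_msupp_subset_closedBall {X : Type*} [PseudoMetricSpace X] [ProperSpace X]
    [SecondCountableTopology X] [MeasurableSpace X] {μ : Measure X} [IsProbabilityMeasure μ]
    {x : X} {r : ℝ} (h : msupp μ ⊆ closedBall x r) : Pc μ :=
  ⟨inferInstance, closedBall x r, isCompact_closedBall x r,
    (ae_mem_msupp μ).mono fun _ hy => h hy⟩

theorem bary_eq {d : ℕ} (m : Measure (Euc d × Euc d)) [hm : IsFiniteMeasure m] :
    bary m = fun x => ∫ v, v ∂(m.condKernel x) := by
  funext x
  simp [bary, disint, hm]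

theorem measurable_bary {d : ℕ} (m : Measure (Euc d × Euc d)) [IsFiniteMeasure m] :
    Measurable (bary m) := by
  rw [bary_eq]
  exact (StronglyMeasurable.integral_kernel (κ := m.condKernel)
    (stronglyMeasurable_id (α := Euc d))).measurable

theorem ae_norm_bary_le {d : ℕ} {m : Measure (Euc d × Euc d)} [IsFiniteMeasure m] {M : ℝ}
    (h : ∀ᵐ p ∂m, ‖p.2‖ ≤ M) : ∀ᵐ x ∂(m.map Prod.fst), ‖bary m x‖ ≤ M := by
  rw [← m.disintegrate m.condKernel] at h
  filter_upwards [Measure.ae_ae_of_ae_compProd h] with x hx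
  rw [bary_eq]
  simpa using norm_integral_le_of_norm_le_const hx

theorem integral_map_add_smul_sub_le {E : Type*} [NormedAddCommGroup E] [NormedSpace ℝ E]
    [MeasurableSpace E] [BorelSpace E] [SecondCountableTopology E]
    {μ : Measure E} [IsProbabilityMeasure μ] {b : E → E} (hb : Measurable b) {K M : ℝ}
    (hK : ∀ᵐ x ∂μ, ‖x‖ ≤ K) (hM : ∀ᵐ x ∂μ, ‖b x‖ ≤ M)
    {f : E → ℝ} (hf : LipschitzWith 1 f) (a c : ℝ) :
    ∫ x, f x ∂(μ.map fun x => x + a • b x) - ∫ x, f x ∂(μ.map fun x => x + c • b x)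
      ≤ M * |a - c| := by
  have hmeas (a : ℝ) : Measurable fun x => x + a • b x := by fun_prop
  have hint (a : ℝ) : Integrable (fun x => f (x + a • b x)) μ := by
    refine Integrable.of_bound (hf.continuous.measurable.comp (hmeas a)).aestronglyMeasurable
      (‖f 0‖ + (K + |a| * M)) ?_
    filter_upwards [hK, hM] with x hx hbx
    have h0 := hf.norm_sub_le (x + a • b x) 0
    have h1 : ‖x + a • b x‖ ≤ K + |a| * M := by
      refine (norm_add_le _ _).trans (add_le_add hx ?_)
      rw [norm_smul, Real.norm_eq_abs]
      gcongr
    have h2 := norm_le_norm_add_norm_sub' (f (x + a • b x)) (f 0)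
    simp only [NNReal.coe_one, one_mul, sub_zero] at h0
    linarith
  rw [integral_map (hmeas a).aemeasurable hf.continuous.measurable.aestronglyMeasurable,
    integral_map (hmeas c).aemeasurable hf.continuous.measurable.aestronglyMeasurable,
    ← integral_sub (hint a) (hint c)]
  calc ∫ x, (f (x + a • b x) - f (x + c • b x)) ∂μ ≤ ∫ _, M * |a - c| ∂μ := by
        refine integral_mono_ae ((hint a).sub (hint c)) (integrable_const _) ?_
        filter_upwards [hM] with x hbx
        have h0 := hf.norm_sub_le (x + a • b x) (x + c • b x)
        rw [add_sub_add_left_eq_sub, ← sub_smul, norm_smul, Real.norm_eq_abs,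
          Real.norm_eq_abs, NNReal.coe_one, one_mul] at h0
        calc f (x + a • b x) - f (x + c • b x) ≤ |a - c| * ‖b x‖ := (le_abs_self _).trans h0
          _ ≤ M * |a - c| := by rw [mul_comm]; gcongr
    _ = M * |a - c| := by simp

theorem sub_le_of_sub_le_on_uniform_grid {F : ℝ → ℝ} {L δ : ℝ} {N : ℕ}
    (h : ∀ j < N, ∀ t ∈ Icc (j * δ) ((j + 1) * δ), ∀ s ∈ Icc (j * δ) ((j + 1) * δ),
      F t - F s ≤ L * |t - s|) :
    ∀ t ∈ Icc 0 (N * δ), ∀ s ∈ Icc 0 (N * δ), F t - F s ≤ L * |t - s| := by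
  induction N with
  | zero =>
    intro t ht s hs
    simp only [Nat.cast_zero, zero_mul, Icc_self, mem_singleton_iff] at ht hs
    simp [ht, hs]
  | succ n ih =>
    have ih := ih fun j hj => h j (by omega)
    have hn := h n (by omega)
    push_cast
    intro t ht s hs
    rcases le_total t (n * δ) with htn | htn <;> rcases le_total s (n * δ) with hsn | hsn
    · exact ih t ⟨ht.1, htn⟩ s ⟨hs.1, hsn⟩
    · have h1 := ih t ⟨ht.1, htn⟩ (n * δ) ⟨ht.1.trans htn, le_rfl⟩
      have h2 := hn (n * δ) ⟨le_rfl, hsn.trans hs.2⟩ s ⟨hsn, hs.2⟩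
      rw [abs_of_nonpos (by linarith)] at h1 h2 ⊢
      linarith
    · have h1 := ih (n * δ) ⟨hs.1.trans hsn, le_rfl⟩ s ⟨hs.1, hsn⟩
      have h2 := hn t ⟨htn, ht.2⟩ (n * δ) ⟨le_rfl, htn.trans ht.2⟩
      rw [abs_of_nonneg (by linarith)] at h1 h2 ⊢
      linarith
    · exact hn t ⟨htn, ht.2⟩ s ⟨hsn, hs.2⟩

section MeanVelocity

variable {d : ℕ} {T : ℝ} {N : ℕ} {V : Measure (Euc d) → Measure (Euc d × Euc d)}
  {μ₀ : Measure (Euc d)}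

theorem isProbabilityMeasure_mvelStep (hV : IsPVF V) [IsProbabilityMeasure μ₀] (j : ℕ) :
    IsProbabilityMeasure (mvelStep T N V μ₀ j) := by
  induction j with
  | zero => simpa [mvelStep]
  | succ j ih =>
    have := (hV _ ih).1
    have := measurable_bary (V (mvelStep T N V μ₀ j))
    exact Measure.isProbabilityMeasure_map (by fun_prop)

theorem mvelT_of_mem_Ioc (hT : 0 < T) (hN : 0 < N) {j : ℕ} {t : ℝ}
    (ht : t ∈ Ioc (j * (T / N)) ((j + 1) * (T / N))) :
    mvelT T N V μ₀ t = (mvelStep T N V μ₀ j).map fun x =>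
      x + (t - j * (T / N)) • bary (V (mvelStep T N V μ₀ j)) x := by
  have hδ : 0 < T / N := by positivity
  have ht0 : ¬ t ≤ 0 := not_le.2 (lt_of_le_of_lt (by positivity) ht.1)
  have hceil : ⌈t / (T / N)⌉ = (j : ℤ) + 1 := by
    rw [Int.ceil_eq_iff]
    push_cast
    exact ⟨by rw [lt_div_iff₀ hδ]; simpa using ht.1, by rw [div_le_iff₀ hδ]; exact ht.2⟩
  have hidx : ⌈t / (T / N)⌉.toNat - 1 = j := by omega
  rw [mvelT, if_neg ht0, hidx]

theorem mvelT_grid (hT : 0 < T) (hN : 0 < N) (j : ℕ) :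
    mvelT T N V μ₀ (j * (T / N)) = mvelStep T N V μ₀ j := by
  have hδ : 0 < T / N := by positivity
  cases j with
  | zero => simp [mvelT, mvelStep]
  | succ k =>
    push_cast
    rw [mvelT_of_mem_Ioc hT hN (j := k) ⟨by nlinarith, le_rfl⟩, mvelStep]
    congr! 4
    ring

theorem mvelT_of_mem_Icc (hT : 0 < T) (hN : 0 < N) {j : ℕ} {t : ℝ}
    (ht : t ∈ Icc (j * (T / N)) ((j + 1) * (T / N))) :
    mvelT T N V μ₀ t = (mvelStep T N V μ₀ j).map fun x =>
      x + (t - j * (T / N)) • bary (V (mvelStep T N V μ₀ j)) x := by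
  rcases ht.1.eq_or_lt with rfl | hlt
  · simp [mvelT_grid hT hN]
  · exact mvelT_of_mem_Ioc hT hN ⟨hlt, ht.2⟩

end MeanVelocity

theorem H1cond.ae_norm_bary_le {d : ℕ} {C K : ℝ} {V : Measure (Euc d) → Measure (Euc d × Euc d)}
    (h1 : H1cond C V) (hV : IsPVF V) (hC : 0 ≤ C) {μ : Measure (Euc d)} [IsProbabilityMeasure μ]
    (hK : msupp μ ⊆ closedBall (0 : Euc d) K) : ∀ᵐ x ∂μ, ‖bary (V μ) x‖ ≤ C * (1 + K) := by
  obtain ⟨_, hfst⟩ := hV μ inferInstance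
  have := (msupp_nonempty μ).to_subtype
  have hsup : ⨆ x : msupp μ, ‖(x : Euc d)‖ ≤ K :=
    ciSup_le fun x => mem_closedBall_zero_iff.1 (hK x.2)
  have hae : ∀ᵐ p ∂(V μ), ‖p.2‖ ≤ C * (1 + K) := by
    filter_upwards [ae_mem_msupp (V μ)] with p hp
    refine (h1 μ (pc_of_msupp_subset_closedBall hK) p hp).trans ?_
    gcongr
  simpa only [hfst] using _root_.ae_norm_bary_le hae

/-- equi-Lipschitz continuity in time of the mean velocity scheme: under
(H1) with constant `C`, if `K` is a uniform bound on the support radii of the scheme, then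
`W(μ̂^N_t, μ̂^N_s) ≤ C(1+K)|t-s|` for all `t,s ∈ [0,T]` and all `N`. -/
theorem mean_velocity_equilipschitz {d : ℕ} (T : ℝ) (hT : 0 < T)
    (V : Measure (Euc d) → Measure (Euc d × Euc d)) (hV : IsPVF V)
    (C : ℝ) (hC : 0 < C) (h1 : H1cond C V)
    (μ₀ : Measure (Euc d)) (hμ₀ : Pc μ₀)
    (R : ℝ) (hR : msupp μ₀ ⊆ ball (0 : Euc d) R)
    (K : ℝ) (hK : ∀ N : ℕ, 0 < N → ∀ j : ℕ, j ≤ N →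
      msupp (mvelStep T N V μ₀ j) ⊆ closedBall (0 : Euc d) K) :
    ∀ N : ℕ, 0 < N → ∀ t ∈ Icc (0 : ℝ) T, ∀ s ∈ Icc (0 : ℝ) T,
      W1 (mvelT T N V μ₀ t) (mvelT T N V μ₀ s) ≤ C * (1 + K) * |t - s| := by
  intro N hN t ht s hs
  have := hμ₀.1
  have hNT : (N : ℝ) * (T / N) = T := mul_div_cancel₀ T (by positivity)
  have : Nonempty {f : Euc d → ℝ // LipschitzWith 1 f} :=
    ⟨⟨fun _ => 0, LipschitzWith.const' 0⟩⟩
  refine ciSup_le fun ⟨f, hf⟩ => ?_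
  refine sub_le_of_sub_le_on_uniform_grid (F := fun t => ∫ x, f x ∂(mvelT T N V μ₀ t))
    (δ := T / N) (N := N) (fun j hj t ht s hs => ?_) t (by rwa [hNT]) s (by rwa [hNT])
  have := isProbabilityMeasure_mvelStep (T := T) (N := N) (μ₀ := μ₀) hV j
  have hKj := hK N hN j hj.le
  have := (hV (mvelStep T N V μ₀ j) inferInstance).1
  have hnorm : ∀ᵐ x ∂(mvelStep T N V μ₀ j), ‖x‖ ≤ K := by
    filter_upwards [ae_mem_msupp (mvelStep T N V μ₀ j)] with x hx
    exact mem_closedBall_zero_iff.1 (hKj hx)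
  simp only [mvelT_of_mem_Icc hT hN ht, mvelT_of_mem_Icc hT hN hs]
  simpa only [sub_sub_sub_cancel_right] using
    integral_map_add_smul_sub_le (measurable_bary _) hnorm
      (h1.ae_norm_bary_le hV hC.le hKj) hf (t - j * (T / N)) (s - j * (T / N))

end
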